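/- arXiv:1703.03842 — 3 statements merged into one kernel-verified Lean document; each statement's English description precedes it below -/
import Mathlib

section
/- For every time step n, every p ≥ 0, and every category j ∈ {1,…,k}, the conditional probability of classifying as category j after p further consecutive classifications as j is at least the original conditional probability: P(x_{n+p} = j | x_{n+p−1} = j, …, x_n = j, F_n) ≥ P(x_n = j | F_n) almost surely. -/
open MeasureTheory Filter Topology

/-- The simple exemplar weight model with finite capacity from the paper
"Effects of Limiting Memory Capacity on the Behaviour of Exemplar Dynamics".

There are `k ≥ 2` categories, each storing at most `N ≥ 1` exemplars, and the
weights decay by `β = exp (-lam)` at each step, `lam > 0`.  `w n j m ω` is the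
weight of the `(m+1)`-st exemplar (positions are 0-based) of category `j` at
time `n`; weights lie in `[0,1]`, are nonincreasing in the position, and vanish
at positions `≥ N`.  The initial weights are deterministic with at least one
nonzero weight.  At each time a random category `x n` is chosen with conditional
probability `W_j^n / W_tot^n` given the natural filtration `F`, where
`W_j^n = ∑_{m<N} w n j m` and `W_tot^n = ∑_j W_j^n`; then the chosen category
gets a fresh exemplar of weight `1` on top, its old exemplars shift down and
decay by `β` (the lowest-weight one being discarded), and all other categories'
exemplars decay by `β`. -/
structure FiniteExemplarModel (Ω : Type*) [mΩ : MeasurableSpace Ω] (μ : Measure Ω)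
    (k N : ℕ) (lam : ℝ) where
  hk : 2 ≤ k
  hN : 1 ≤ N
  hlam : 0 < lam
  hprob : IsProbabilityMeasure μ
  /-- the exemplar weights: time, category, (0-based) position, outcome -/
  w : ℕ → Fin k → ℕ → Ω → ℝ
  /-- the category the sound at time `n` is classified as -/
  x : ℕ → Ω → Fin k
  /-- the natural filtration `F_n = σ(w^q, 0 < q ≤ n)` -/
  F : Filtration ℕ mΩ
  range01 : ∀ n j m ω, 0 ≤ w n j m ω ∧ w n j m ω ≤ 1
  mono : ∀ n j m ω, w n j (m + 1) ω ≤ w n j m ω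
  cap : ∀ n j m ω, N ≤ m → w n j m ω = 0
  init_det : ∀ j m ω ω', w 0 j m ω = w 0 j m ω'
  init_nonzero : ∃ j m ω, w 0 j m ω ≠ 0
  w_meas : ∀ n j m, StronglyMeasurable[F n] (w n j m)
  x_meas : ∀ n, Measurable[F (n + 1)] (x n)
  dyn_self_first : ∀ n ω, w (n + 1) (x n ω) 0 ω = 1
  dyn_self : ∀ n ω m, m + 1 < N →
    w (n + 1) (x n ω) (m + 1) ω = Real.exp (-lam) * w n (x n ω) m ω
  dyn_other : ∀ n ω i m, i ≠ x n ω →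
    w (n + 1) i m ω = Real.exp (-lam) * w n i m ω
  classify : ∀ n (j : Fin k),
    μ[Set.indicator {ω | x n ω = j} (fun _ => (1 : ℝ)) | F n]
      =ᵐ[μ] fun ω => (∑ m ∈ Finset.range N, w n j m ω) /
        (∑ i : Fin k, ∑ m ∈ Finset.range N, w n i m ω)

namespace FiniteExemplarModel

variable {Ω : Type*} [mΩ : MeasurableSpace Ω] {μ : Measure Ω} {k N : ℕ} {lam : ℝ}

/-- The total weight of category `j` at time `n`. -/
noncomputable def catWeight (M : FiniteExemplarModel Ω μ k N lam) (n : ℕ) (j : Fin k) (ω : Ω) : ℝ :=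
  ∑ m ∈ Finset.range N, M.w n j m ω

/-- The share of category `j` in the total weight at time `n`. -/
noncomputable def share (M : FiniteExemplarModel Ω μ k N lam) (n : ℕ) (j : Fin k) (ω : Ω) : ℝ :=
  M.catWeight n j ω / ∑ i, M.catWeight n i ω

variable (M : FiniteExemplarModel Ω μ k N lam)

lemma catWeight_nonneg (n : ℕ) (j : Fin k) (ω : Ω) : 0 ≤ M.catWeight n j ω :=
  Finset.sum_nonneg fun m _ => (M.range01 n j m ω).1

lemma catWeight_succ_of_ne (n : ℕ) {i : Fin k} {ω : Ω} (h : i ≠ M.x n ω) :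
    M.catWeight (n + 1) i ω = Real.exp (-lam) * M.catWeight n i ω := by
  simp only [catWeight, Finset.mul_sum]
  exact Finset.sum_congr rfl fun m _ => M.dyn_other n ω i m h

lemma exp_mul_catWeight_le_succ (n : ℕ) (ω : Ω) :
    Real.exp (-lam) * M.catWeight n (M.x n ω) ω ≤ M.catWeight (n + 1) (M.x n ω) ω := by
  obtain ⟨K, hK⟩ : ∃ K, N = K + 1 := Nat.exists_eq_succ_of_ne_zero (by have := M.hN; omega)
  have hsum : ∑ m ∈ Finset.range K, M.w (n + 1) (M.x n ω) (m + 1) ω =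
      Real.exp (-lam) * ∑ m ∈ Finset.range K, M.w n (M.x n ω) m ω := by
    rw [Finset.mul_sum]
    refine Finset.sum_congr rfl fun m hm => M.dyn_self n ω m ?_
    have := Finset.mem_range.1 hm
    omega
  have hlast : Real.exp (-lam) * M.w n (M.x n ω) K ω ≤ 1 :=
    mul_le_one₀ (Real.exp_le_one_iff.2 (by linarith [M.hlam])) (M.range01 _ _ _ _).1
      (M.range01 _ _ _ _).2
  have hN : Finset.range N = Finset.range (K + 1) := by rw [hK]
  simp only [catWeight, hN]
  rw [Finset.sum_range_succ, Finset.sum_range_succ', hsum, M.dyn_self_first]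
  linarith

lemma share_le_share_succ {n : ℕ} {j : Fin k} {ω : Ω} (h : M.x n ω = j) :
    M.share n j ω ≤ M.share (n + 1) j ω := by
  have hβ := Real.exp_pos (-lam)
  have hself := M.exp_mul_catWeight_le_succ n ω
  rw [h] at hself
  have hother : ∑ i ∈ Finset.univ.erase j, M.catWeight (n + 1) i ω =
      Real.exp (-lam) * ∑ i ∈ Finset.univ.erase j, M.catWeight n i ω := by
    rw [Finset.mul_sum]
    refine Finset.sum_congr rfl fun i hi => M.catWeight_succ_of_ne n ?_
    rw [h]
    exact Finset.ne_of_mem_erase hi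
  have ha := M.catWeight_nonneg n j ω
  have ha' := M.catWeight_nonneg (n + 1) j ω
  have hb : 0 ≤ ∑ i ∈ Finset.univ.erase j, M.catWeight n i ω :=
    Finset.sum_nonneg fun i _ => M.catWeight_nonneg n i ω
  rw [share, share, ← Finset.add_sum_erase _ _ (Finset.mem_univ j),
    ← Finset.add_sum_erase _ (fun i => M.catWeight (n + 1) i ω) (Finset.mem_univ j), hother]
  generalize ∑ i ∈ Finset.univ.erase j, M.catWeight n i ω = b at *
  generalize M.catWeight n j ω = a at *
  generalize M.catWeight (n + 1) j ω = a' at *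
  rcases ha.eq_or_lt with rfl | ha_pos
  · rw [zero_div]
    positivity
  · have ha'_pos : 0 < a' := (mul_pos hβ ha_pos).trans_le hself
    rw [div_le_div_iff₀ (by positivity) (by positivity)]
    nlinarith [mul_le_mul_of_nonneg_right hself hb]

lemma share_le_share_add {n p : ℕ} {j : Fin k} {ω : Ω} (h : ∀ i < p, M.x (n + i) ω = j) :
    M.share n j ω ≤ M.share (n + p) j ω := by
  induction p with
  | zero => rfl
  | succ p ih =>
    exact (ih fun i hi => h i (hi.trans p.lt_succ_self)).trans
      (M.share_le_share_succ (h p p.lt_succ_self))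

lemma share_nonneg (n : ℕ) (j : Fin k) (ω : Ω) : 0 ≤ M.share n j ω :=
  div_nonneg (M.catWeight_nonneg n j ω) (Finset.sum_nonneg fun i _ => M.catWeight_nonneg n i ω)

lemma share_le_one (n : ℕ) (j : Fin k) (ω : Ω) : M.share n j ω ≤ 1 :=
  div_le_one_of_le₀
    (Finset.single_le_sum (fun i _ => M.catWeight_nonneg n i ω) (Finset.mem_univ j))
    (Finset.sum_nonneg fun i _ => M.catWeight_nonneg n i ω)

lemma stronglyMeasurable_share (n : ℕ) (j : Fin k) : StronglyMeasurable[M.F n] (M.share n j) := by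
  have h : ∀ i, StronglyMeasurable[M.F n] (M.catWeight n i) := fun i =>
    Finset.stronglyMeasurable_fun_sum _ fun m _ => M.w_meas n i m
  exact ((h j).measurable.div
    (Finset.stronglyMeasurable_fun_sum _ fun i _ => h i).measurable).stronglyMeasurable

lemma integrable_share (n : ℕ) (j : Fin k) : Integrable (M.share n j) μ := by
  have := M.hprob
  refine Integrable.of_bound ((M.stronglyMeasurable_share n j).mono (M.F.le n)).aestronglyMeasurable
    1 (ae_of_all _ fun ω => ?_)
  rw [Real.norm_of_nonneg (M.share_nonneg n j ω)]
  exact M.share_le_one n j ω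

lemma measurableSet_x_eq (n : ℕ) (j : Fin k) :
    MeasurableSet[M.F (n + 1)] {ω | M.x n ω = j} :=
  M.x_meas n (measurableSet_singleton j)

lemma measurableSet_run (n p : ℕ) (j : Fin k) :
    MeasurableSet[M.F (n + p)] {ω | ∀ i < p, M.x (n + i) ω = j} := by
  simp only [Set.ofPred_forall]
  exact MeasurableSet.iInter fun i => MeasurableSet.iInter fun hi =>
    M.F.mono (show n + i + 1 ≤ n + p by omega) _ (M.measurableSet_x_eq (n + i) j)

end FiniteExemplarModel

/-- **Lemma 1 of the paper.** For every time step `n`, every `p ≥ 0` and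
every category `j`, almost surely
`P(x_{n+p} = j | x_{n+p-1} = j, …, x_n = j, F_n) ≥ P(x_n = j | F_n)`;
equivalently (multiplying through by the conditional probability of the
conditioning event `E = {x_n = j, …, x_{n+p-1} = j}`):
`P({x_{n+p} = j} ∩ E | F_n) ≥ P(x_n = j | F_n) · P(E | F_n)` a.s. -/
theorem consecutive_classification_increases_probability
    {Ω : Type*} [mΩ : MeasurableSpace Ω] {μ : Measure Ω} {k N : ℕ} {lam : ℝ}
    (M : FiniteExemplarModel Ω μ k N lam) (n p : ℕ) (j : Fin k) :
    ∀ᵐ ω ∂μ,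
      (μ[Set.indicator {ω' | M.x (n + p) ω' = j ∧ ∀ i < p, M.x (n + i) ω' = j}
          (fun _ => (1 : ℝ)) | M.F n]) ω ≥
      (μ[Set.indicator {ω' | M.x n ω' = j} (fun _ => (1 : ℝ)) | M.F n]) ω *
        (μ[Set.indicator {ω' | ∀ i < p, M.x (n + i) ω' = j}
          (fun _ => (1 : ℝ)) | M.F n]) ω := by
  have := M.hprob
  set E : Set Ω := {ω | ∀ i < p, M.x (n + i) ω = j}
  have hE : MeasurableSet[M.F (n + p)] E := M.measurableSet_run n p j
  have hE' : MeasurableSet E := M.F.le _ _ hE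
  have hset : Set.indicator {ω' | M.x (n + p) ω' = j ∧ ∀ i < p, M.x (n + i) ω' = j}
      (fun _ => (1 : ℝ)) = E.indicator (Set.indicator {ω | M.x (n + p) ω = j} fun _ => 1) := by
    rw [Set.indicator_indicator, Set.inter_comm]
    rfl
  have hstep : μ[E.indicator (Set.indicator {ω | M.x (n + p) ω = j} fun _ => (1 : ℝ)) | M.F (n + p)]
      =ᵐ[μ] E.indicator (M.share (n + p) j) := by
    refine (condExp_indicator ((integrable_const 1).indicator
      (M.F.le _ _ (M.measurableSet_x_eq (n + p) j))) hE).trans ?_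
    filter_upwards [M.classify (n + p) j] with ω hω
    by_cases h : ω ∈ E
    · rw [Set.indicator_of_mem h, Set.indicator_of_mem h, hω]
      rfl
    · rw [Set.indicator_of_notMem h, Set.indicator_of_notMem h]
  have htower := (condExp_condExp_of_le (μ := μ)
    (f := E.indicator (Set.indicator {ω | M.x (n + p) ω = j} fun _ => (1 : ℝ)))
    (M.F.mono (Nat.le_add_right n p)) (M.F.le (n + p))).symm.trans (condExp_congr_ae hstep)
  have hint : Integrable (M.share n j * E.indicator fun _ => (1 : ℝ)) μ := by
    refine ((M.integrable_share n j).indicator hE').congr (ae_of_all _ fun ω => ?_)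
    by_cases h : ω ∈ E <;> simp [h]
  have hmono : μ[M.share n j * E.indicator fun _ => (1 : ℝ) | M.F n] ≤ᵐ[μ]
      μ[E.indicator (M.share (n + p) j) | M.F n] := by
    refine condExp_mono hint ((M.integrable_share (n + p) j).indicator hE')
      (ae_of_all _ fun ω => ?_)
    by_cases h : ω ∈ E
    · simpa [h] using M.share_le_share_add h
    · simp [h]
  have hpull := condExp_mul_of_stronglyMeasurable_left (M.stronglyMeasurable_share n j) hint
    ((integrable_const 1).indicator hE')
  rw [hset]
  filter_upwards [htower, hmono, hpull, M.classify n j] with ω h₁ h₂ h₃ h₄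
  rw [h₁, h₄, ge_iff_le]
  exact h₃.symm.trans_le h₂
end

section
/- For each category j ∈ {1,…,k}, the process Z_j^n = W_j^n / W_tot^n is a martingale with respect to the natural filtration {F_n}: Z_j^n is F_n-measurable, E|Z_j^n| ≤ 1, and E[Z_j^{n+1} | F_n] = Z_j^n almost surely for all n. -/
open MeasureTheory Filter Topology

/-- The simple exemplar weight model with unlimited capacity (`N = ∞`) from the
paper "Effects of Limiting Memory Capacity on the Behaviour of Exemplar Dynamics".

There are `k ≥ 2` categories and the weights decay by `β = exp (-lam)` at each
step, `lam > 0`.  `W n j ω` is the total weight of category `j` at time `n`;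
the initial weights are deterministic, nonnegative and not all zero.  At each
time a random category `x n` is chosen with conditional probability
`W_j^n / W_tot^n` given the natural filtration `F`, where `W_tot^n = ∑_j W_j^n`;
then `W_{x_n}^{n+1} = β W_{x_n}^n + 1` and `W_i^{n+1} = β W_i^n` for `i ≠ x_n`. -/
structure InfiniteExemplarModel (Ω : Type*) [mΩ : MeasurableSpace Ω] (μ : Measure Ω)
    (k : ℕ) (lam : ℝ) where
  hk : 2 ≤ k
  hlam : 0 < lam
  hprob : IsProbabilityMeasure μ
  /-- the total weight of each category at each time -/
  W : ℕ → Fin k → Ω → ℝ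
  /-- the category the sound at time `n` is classified as -/
  x : ℕ → Ω → Fin k
  /-- the natural filtration of the process -/
  F : Filtration ℕ mΩ
  nonneg : ∀ n j ω, 0 ≤ W n j ω
  init_det : ∀ j ω ω', W 0 j ω = W 0 j ω'
  init_nonzero : ∃ j ω, W 0 j ω ≠ 0
  W_meas : ∀ n j, StronglyMeasurable[F n] (W n j)
  x_meas : ∀ n, Measurable[F (n + 1)] (x n)
  dyn_self : ∀ n ω, W (n + 1) (x n ω) ω = Real.exp (-lam) * W n (x n ω) ω + 1
  dyn_other : ∀ n ω i, i ≠ x n ω → W (n + 1) i ω = Real.exp (-lam) * W n i ω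
  classify : ∀ n (j : Fin k),
    μ[Set.indicator {ω | x n ω = j} (fun _ => (1 : ℝ)) | F n]
      =ᵐ[μ] fun ω => W n j ω / (∑ i : Fin k, W n i ω)

namespace InfiniteExemplarModel

variable {Ω : Type*} [mΩ : MeasurableSpace Ω] {μ : Measure Ω} {k : ℕ} {lam : ℝ}
  (M : InfiniteExemplarModel Ω μ k lam)

theorem weight_succ (n : ℕ) (j : Fin k) (ω : Ω) :
    M.W (n + 1) j ω = Real.exp (-lam) * M.W n j ω + if j = M.x n ω then 1 else 0 := by
  split_ifs with h
  · subst h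
    exact M.dyn_self n ω
  · rw [M.dyn_other n ω j h, add_zero]

theorem sum_weight_succ (n : ℕ) (ω : Ω) :
    ∑ i, M.W (n + 1) i ω = Real.exp (-lam) * (∑ i, M.W n i ω) + 1 := by
  simp [M.weight_succ, Finset.sum_add_distrib, Finset.mul_sum]

theorem sum_weight_pos (n : ℕ) (ω : Ω) : 0 < ∑ i, M.W n i ω := by
  cases n with
  | zero =>
    obtain ⟨j, ω', h⟩ := M.init_nonzero
    rw [M.init_det j ω' ω] at h
    exact Finset.sum_pos' (fun i _ => M.nonneg 0 i ω)
      ⟨j, Finset.mem_univ j, (M.nonneg 0 j ω).lt_of_ne' h⟩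
  | succ n =>
    rw [M.sum_weight_succ]
    have := Finset.sum_nonneg fun i (_ : i ∈ Finset.univ) => M.nonneg n i ω
    positivity

theorem stronglyMeasurable_sum_weight (n : ℕ) :
    StronglyMeasurable[M.F n] fun ω => ∑ i, M.W n i ω :=
  Finset.stronglyMeasurable_fun_sum _ fun i _ => M.W_meas n i

theorem stronglyMeasurable_fraction (n : ℕ) (j : Fin k) :
    StronglyMeasurable[M.F n] fun ω => M.W n j ω / ∑ i, M.W n i ω :=
  (M.W_meas n j).div₀ (M.stronglyMeasurable_sum_weight n) fun ω => (M.sum_weight_pos n ω).ne'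

theorem abs_fraction_le_one (n : ℕ) (j : Fin k) (ω : Ω) :
    |M.W n j ω / ∑ i, M.W n i ω| ≤ 1 := by
  rw [abs_of_nonneg (div_nonneg (M.nonneg n j ω) (M.sum_weight_pos n ω).le)]
  exact div_le_one_of_le₀
    (Finset.single_le_sum (fun i _ => M.nonneg n i ω) (Finset.mem_univ j))
    (M.sum_weight_pos n ω).le

theorem integrable_fraction (n : ℕ) (j : Fin k) :
    Integrable (fun ω => M.W n j ω / ∑ i, M.W n i ω) μ := by
  have := M.hprob
  exact Integrable.of_bound
    ((M.stronglyMeasurable_fraction n j).mono (M.F.le n)).aestronglyMeasurable 1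
    (ae_of_all _ (M.abs_fraction_le_one n j))

theorem fraction_succ (n : ℕ) (j : Fin k) :
    (fun ω => M.W (n + 1) j ω / ∑ i, M.W (n + 1) i ω) =
      (fun ω => Real.exp (-lam) * M.W n j ω / (Real.exp (-lam) * (∑ i, M.W n i ω) + 1)) +
      (fun ω => (Real.exp (-lam) * (∑ i, M.W n i ω) + 1)⁻¹) *
        Set.indicator {ω | M.x n ω = j} (fun _ => (1 : ℝ)) := by
  ext ω
  rw [M.sum_weight_succ, M.weight_succ]
  simp only [Pi.add_apply, Pi.mul_apply, Set.indicator_apply, Set.mem_ofPred_eq, eq_comm (a := j)]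
  ring

theorem condExp_fraction_succ (n : ℕ) (j : Fin k) :
    μ[fun ω => M.W (n + 1) j ω / (∑ i, M.W (n + 1) i ω) | M.F n]
      =ᵐ[μ] fun ω => M.W n j ω / (∑ i, M.W n i ω) := by
  have := M.hprob
  have hpos (ω : Ω) : 0 < Real.exp (-lam) * (∑ i, M.W n i ω) + 1 := by
    have := M.sum_weight_pos n ω
    positivity
  have hS : StronglyMeasurable[M.F n] fun ω => Real.exp (-lam) * (∑ i, M.W n i ω) + 1 :=
    ((M.stronglyMeasurable_sum_weight n).const_mul _).add_const _
  have hA : StronglyMeasurable[M.F n] fun ω =>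
      Real.exp (-lam) * M.W n j ω / (Real.exp (-lam) * (∑ i, M.W n i ω) + 1) :=
    ((M.W_meas n j).const_mul _).div₀ hS fun ω => (hpos ω).ne'
  have hB : StronglyMeasurable[M.F n] fun ω => (Real.exp (-lam) * (∑ i, M.W n i ω) + 1)⁻¹ :=
    hS.inv₀
  have hx : MeasurableSet {ω | M.x n ω = j} :=
    M.F.le (n + 1) _ (M.x_meas n (measurableSet_singleton j))
  have hI : Integrable (Set.indicator {ω | M.x n ω = j} (fun _ => (1 : ℝ))) μ :=
    (integrable_const 1).indicator hx
  have hBI : Integrable ((fun ω => (Real.exp (-lam) * (∑ i, M.W n i ω) + 1)⁻¹) *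
      Set.indicator {ω | M.x n ω = j} (fun _ => (1 : ℝ))) μ := by
    refine hI.bdd_mul (c := 1) (hB.mono (M.F.le n)).aestronglyMeasurable (ae_of_all _ fun ω => ?_)
    rw [Real.norm_of_nonneg (inv_nonneg.2 (hpos ω).le)]
    refine inv_le_one_of_one_le₀ ?_
    have := M.sum_weight_pos n ω
    exact le_add_of_nonneg_left (by positivity)
  have hAI : Integrable (fun ω =>
      Real.exp (-lam) * M.W n j ω / (Real.exp (-lam) * (∑ i, M.W n i ω) + 1)) μ := by
    have h := (M.integrable_fraction (n + 1) j).sub hBI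
    rwa [M.fraction_succ, add_sub_cancel_right] at h
  rw [M.fraction_succ]
  filter_upwards [condExp_add hAI hBI (M.F n),
    condExp_mul_of_stronglyMeasurable_left hB hBI hI, M.classify n j] with ω h₁ h₂ h₃
  rw [h₁, Pi.add_apply, condExp_of_stronglyMeasurable (M.F.le n) hA hAI, h₂, Pi.mul_apply, h₃]
  have h₄ := (hpos ω).ne'
  have h₅ := (M.sum_weight_pos n ω).ne'
  field_simp

end InfiniteExemplarModel

/-- **Lemma 3 of the paper.** For each category `j`, the process
`Z_j^n = W_j^n / W_tot^n` is a martingale with respect to the natural filtration: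
it is adapted (each `Z_j^n` is `F_n`-measurable), integrable with
`E|Z_j^n| ≤ 1`, and `E[Z_j^{n+1} | F_n] = Z_j^n` a.s. for all `n`. -/
theorem weight_fraction_is_martingale
    {Ω : Type*} [mΩ : MeasurableSpace Ω] {μ : Measure Ω} {k : ℕ} {lam : ℝ}
    (M : InfiniteExemplarModel Ω μ k lam) (j : Fin k) :
    Martingale (fun n ω => M.W n j ω / (∑ i : Fin k, M.W n i ω)) M.F μ ∧
    (∀ n, ∫ ω, |M.W n j ω / (∑ i : Fin k, M.W n i ω)| ∂μ ≤ 1) ∧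
    (∀ n, μ[fun ω => M.W (n + 1) j ω / (∑ i : Fin k, M.W (n + 1) i ω) | M.F n]
      =ᵐ[μ] fun ω => M.W n j ω / (∑ i : Fin k, M.W n i ω)) := by
  have := M.hprob
  refine ⟨martingale_nat (M.stronglyMeasurable_fraction · j) (M.integrable_fraction · j)
    fun n => (M.condExp_fraction_succ n j).symm, fun n => ?_, fun n => M.condExp_fraction_succ n j⟩
  calc ∫ ω, |M.W n j ω / (∑ i : Fin k, M.W n i ω)| ∂μ
      ≤ ∫ _, (1 : ℝ) ∂μ :=
        integral_mono (M.integrable_fraction n j).abs (integrable_const 1)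
          (M.abs_fraction_le_one n j)
    _ = 1 := by simp
end

section
/- With probability 1 there exists exactly one category j such that Z_j^n → 1, and for every other category i ≠ j one has W_i^n → 0 as n → ∞; that is, in the unlimited-capacity model all categories but one become extinct with probability 1. -/
open MeasureTheory Filter Topology

namespace InfiniteExemplarModel

variable {Ω : Type*} [mΩ : MeasurableSpace Ω] {μ : Measure Ω} {k : ℕ} {lam : ℝ}

/-- The total weight of all categories. -/
def total (M : InfiniteExemplarModel Ω μ k lam) (n : ℕ) (ω : Ω) : ℝ := ∑ i : Fin k, M.W n i ω

/-- The relative weight of category `j`. -/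
noncomputable def share (M : InfiniteExemplarModel Ω μ k lam) (j : Fin k) (n : ℕ) (ω : Ω) : ℝ :=
  M.W n j ω / M.total n ω

/-- The indicator of the event that category `j` is chosen at time `n`. -/
noncomputable def chosen (M : InfiniteExemplarModel Ω μ k lam) (j : Fin k) (n : ℕ) : Ω → ℝ :=
  Set.indicator {ω | M.x n ω = j} (fun _ => (1 : ℝ))

theorem chosen_of_eq (M : InfiniteExemplarModel Ω μ k lam) {j : Fin k} {n : ℕ} {ω : Ω}
    (h : M.x n ω = j) : M.chosen j n ω = 1 := by
  simp [chosen, h]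

theorem W_succ (M : InfiniteExemplarModel Ω μ k lam) (n : ℕ) (j : Fin k) (ω : Ω) :
    M.W (n + 1) j ω = Real.exp (-lam) * M.W n j ω + M.chosen j n ω := by
  by_cases h : M.x n ω = j
  · subst h
    rw [M.dyn_self, M.chosen_of_eq rfl]
  · rw [M.dyn_other n ω j (Ne.symm h)]
    simp [chosen, h]

theorem total_succ (M : InfiniteExemplarModel Ω μ k lam) (n : ℕ) (ω : Ω) :
    M.total (n + 1) ω = Real.exp (-lam) * M.total n ω + 1 := by
  have h : ∑ i : Fin k, M.chosen i n ω = 1 := by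
    simp [chosen, Set.indicator_apply]
  simp_rw [total, M.W_succ, Finset.sum_add_distrib, ← Finset.mul_sum, h]

theorem total_nonneg (M : InfiniteExemplarModel Ω μ k lam) (n : ℕ) (ω : Ω) :
    0 ≤ M.total n ω :=
  Finset.sum_nonneg fun i _ => M.nonneg n i ω

theorem one_le_total_succ (M : InfiniteExemplarModel Ω μ k lam) (n : ℕ) (ω : Ω) :
    1 ≤ M.total (n + 1) ω := by
  rw [total_succ]
  have := mul_nonneg (Real.exp_pos (-lam)).le (M.total_nonneg n ω)
  linarith

theorem total_pos (M : InfiniteExemplarModel Ω μ k lam) (n : ℕ) (ω : Ω) : 0 < M.total n ω := by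
  cases n with
  | zero =>
    obtain ⟨j, ω', h⟩ := M.init_nonzero
    rw [M.init_det j ω' ω] at h
    exact Finset.sum_pos' (fun i _ => M.nonneg 0 i ω)
      ⟨j, Finset.mem_univ j, lt_of_le_of_ne (M.nonneg 0 j ω) h.symm⟩
  | succ n => linarith [M.one_le_total_succ n ω]

theorem total_eq_total (M : InfiniteExemplarModel Ω μ k lam) (n : ℕ) (ω ω' : Ω) :
    M.total n ω = M.total n ω' := by
  induction n with
  | zero => exact Finset.sum_congr rfl fun i _ => M.init_det i ω ω'
  | succ n ih => rw [total_succ, total_succ, ih]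

theorem exists_total_le (M : InfiniteExemplarModel Ω μ k lam) (ω : Ω) :
    ∃ C, ∀ n, M.total n ω ≤ C := by
  have hβ : Real.exp (-lam) < 1 := Real.exp_lt_one_iff.2 (neg_neg_of_pos M.hlam)
  have hβ' : 0 < 1 - Real.exp (-lam) := sub_pos.2 hβ
  refine ⟨M.total 0 ω + 1 / (1 - Real.exp (-lam)), fun n => ?_⟩
  induction n with
  | zero => exact le_add_of_nonneg_right (by positivity)
  | succ n ih =>
    have hD : (1 - Real.exp (-lam)) * (1 / (1 - Real.exp (-lam))) = 1 := by field_simp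
    rw [total_succ]
    nlinarith [mul_le_mul_of_nonneg_left ih (Real.exp_pos (-lam)).le, M.total_nonneg 0 ω]

theorem share_nonneg (M : InfiniteExemplarModel Ω μ k lam) (j : Fin k) (n : ℕ) (ω : Ω) :
    0 ≤ M.share j n ω :=
  div_nonneg (M.nonneg n j ω) (M.total_nonneg n ω)

theorem W_le_total (M : InfiniteExemplarModel Ω μ k lam) (j : Fin k) (n : ℕ) (ω : Ω) :
    M.W n j ω ≤ M.total n ω :=
  Finset.single_le_sum (f := fun i => M.W n i ω) (fun i _ => M.nonneg n i ω) (Finset.mem_univ j)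

theorem share_le_one (M : InfiniteExemplarModel Ω μ k lam) (j : Fin k) (n : ℕ) (ω : Ω) :
    M.share j n ω ≤ 1 :=
  (div_le_one (M.total_pos n ω)).2 (M.W_le_total j n ω)

theorem share_succ (M : InfiniteExemplarModel Ω μ k lam) (j : Fin k) (n : ℕ) (ω : Ω) :
    M.share j (n + 1) ω =
      M.share j n ω + (M.total (n + 1) ω)⁻¹ * (M.chosen j n ω - M.share j n ω) := by
  have h0 := (M.total_pos n ω).ne'
  have h1 := (M.total_pos (n + 1) ω).ne'
  rw [share, share, W_succ]
  field_simp
  rw [total_succ]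
  ring

theorem stronglyMeasurable_share (M : InfiniteExemplarModel Ω μ k lam) (j : Fin k) (n : ℕ) :
    StronglyMeasurable[M.F n] (M.share j n) := by
  have hW : ∀ i, Measurable[M.F n] (M.W n i) := fun i => (M.W_meas n i).measurable
  have ht : Measurable[M.F n] fun ω => ∑ i : Fin k, M.W n i ω :=
    Finset.measurable_fun_sum _ fun i _ => hW i
  exact ((hW j).div ht).stronglyMeasurable

theorem integrable_share (M : InfiniteExemplarModel Ω μ k lam) (j : Fin k) (n : ℕ) :
    Integrable (M.share j n) μ := by
  have := M.hprob
  refine Integrable.of_bound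
    ((M.stronglyMeasurable_share j n).mono (M.F.le n)).aestronglyMeasurable 1 (ae_of_all _ fun ω => ?_)
  rw [Real.norm_of_nonneg (M.share_nonneg j n ω)]
  exact M.share_le_one j n ω

theorem integrable_chosen (M : InfiniteExemplarModel Ω μ k lam) (j : Fin k) (n : ℕ) :
    Integrable (M.chosen j n) μ := by
  have := M.hprob
  have hx : MeasurableSet {ω | M.x n ω = j} :=
    M.F.le (n + 1) _ (M.x_meas n (measurableSet_singleton j))
  exact (integrable_const (1 : ℝ)).indicator hx

theorem martingale_share (M : InfiniteExemplarModel Ω μ k lam) (j : Fin k) :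
    Martingale (M.share j) M.F μ := by
  have := M.hprob
  refine martingale_nat (fun n => M.stronglyMeasurable_share j n) (M.integrable_share j)
    fun n => ?_
  obtain ⟨ω₀⟩ : Nonempty Ω := nonempty_of_isProbabilityMeasure μ
  have hsucc : M.share j (n + 1) =
      M.share j n + (M.total (n + 1) ω₀)⁻¹ • (M.chosen j n - M.share j n) := by
    funext ω
    rw [share_succ, M.total_eq_total (n + 1) ω ω₀]
    rfl
  have hself : μ[M.share j n | M.F n] = M.share j n :=
    condExp_of_stronglyMeasurable (M.F.le n) (M.stronglyMeasurable_share j n)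
      (M.integrable_share j n)
  have hdiff : Integrable (M.chosen j n - M.share j n) μ :=
    (M.integrable_chosen j n).sub (M.integrable_share j n)
  rw [hsucc]
  filter_upwards [condExp_add (M.integrable_share j n)
      (hdiff.smul (M.total (n + 1) ω₀)⁻¹) (M.F n),
    condExp_smul (M.total (n + 1) ω₀)⁻¹ (M.chosen j n - M.share j n) (M.F n) (μ := μ),
    condExp_sub (M.integrable_chosen j n) (M.integrable_share j n) (M.F n),
    M.classify n j] with ω hadd hsmul hsub hcl
  have hcl' : (μ[M.chosen j n | M.F n]) ω = M.share j n ω := hcl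
  rw [hadd, Pi.add_apply, hsmul, Pi.smul_apply, hsub, Pi.sub_apply, hself, hcl', sub_self,
    smul_zero, add_zero]

theorem ae_exists_tendsto_share (M : InfiniteExemplarModel Ω μ k lam) (j : Fin k) :
    ∀ᵐ ω ∂μ, ∃ c, Tendsto (fun n => M.share j n ω) atTop (𝓝 c) := by
  have := M.hprob
  refine (M.martingale_share j).submartingale.exists_ae_tendsto_of_bdd (R := 1) fun n => ?_
  have h := eLpNorm_le_of_ae_bound (p := 1) (μ := μ) (f := M.share j n) (C := 1)
    (ae_of_all _ fun ω => by
      rw [Real.norm_of_nonneg (M.share_nonneg j n ω)]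
      exact M.share_le_one j n ω)
  simpa using h

/-- A convergent share of a category that is chosen infinitely often tends to `1`. -/
theorem tendsto_share_one (M : InfiniteExemplarModel Ω μ k lam) {j : Fin k} {ω : Ω} {c : ℝ}
    (hc : Tendsto (fun n => M.share j n ω) atTop (𝓝 c)) (hj : ∃ᶠ n in atTop, M.x n ω = j) :
    Tendsto (fun n => M.share j n ω) atTop (𝓝 1) := by
  obtain ⟨C, hC⟩ := M.exists_total_le ω
  have hstep : Tendsto (fun n => C * |M.share j (n + 1) ω - M.share j n ω|) atTop (𝓝 0) := by
    simpa using (((tendsto_add_atTop_iff_nat 1).2 hc).sub hc).abs.const_mul C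
  have hle : ∃ᶠ n in atTop,
      1 - M.share j n ω ≤ C * |M.share j (n + 1) ω - M.share j n ω| := by
    refine hj.mono fun n hn => ?_
    have hpos := M.total_pos (n + 1) ω
    have heq : M.total (n + 1) ω * (M.share j (n + 1) ω - M.share j n ω) =
        1 - M.share j n ω := by
      rw [share_succ, M.chosen_of_eq hn]
      field_simp
      ring
    rw [← heq]
    exact (mul_le_mul_of_nonneg_left (le_abs_self _) hpos.le).trans
      (mul_le_mul_of_nonneg_right (hC _) (abs_nonneg _))
  have h1 : 1 - c ≤ 0 := le_of_tendsto_of_tendsto_of_frequently (hc.const_sub 1) hstep hle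
  have h2 : c ≤ 1 := le_of_tendsto' hc fun n => M.share_le_one j n ω
  rwa [show c = 1 by linarith] at hc

theorem tendsto_W_zero (M : InfiniteExemplarModel Ω μ k lam) {i j : Fin k} {ω : Ω} (hij : i ≠ j)
    (hj : Tendsto (fun n => M.share j n ω) atTop (𝓝 1)) :
    Tendsto (fun n => M.W n i ω) atTop (𝓝 0) := by
  obtain ⟨C, hC⟩ := M.exists_total_le ω
  have hlim : Tendsto (fun n => C * (1 - M.share j n ω)) atTop (𝓝 0) := by
    simpa using (hj.const_sub 1).const_mul C
  refine squeeze_zero (fun n => M.nonneg n i ω) (fun n => ?_) hlim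
  have hpair : M.W n i ω + M.W n j ω ≤ M.total n ω := by
    rw [← Finset.sum_pair (f := fun l => M.W n l ω) hij]
    exact Finset.sum_le_sum_of_subset_of_nonneg (Finset.subset_univ _)
      fun l _ _ => M.nonneg n l ω
  have heq : M.total n ω * (1 - M.share j n ω) = M.total n ω - M.W n j ω := by
    have := (M.total_pos n ω).ne'
    rw [share]
    field_simp
  have := mul_le_mul_of_nonneg_right (hC n) (sub_nonneg.2 (M.share_le_one j n ω))
  linarith

theorem share_succ_le_W (M : InfiniteExemplarModel Ω μ k lam) (j : Fin k) (n : ℕ) (ω : Ω) :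
    M.share j (n + 1) ω ≤ M.W (n + 1) j ω :=
  div_le_self (M.nonneg _ j ω) (M.one_le_total_succ n ω)

end InfiniteExemplarModel

/-- **Theorem 4 of the paper.** In the unlimited-capacity model, with
probability `1` there exists exactly one category `j` such that
`Z_j^n = W_j^n / W_tot^n → 1`, and for every other category `i ≠ j` one has
`W_i^n → 0` as `n → ∞`: all categories but one become extinct with probability `1`. -/
theorem unlimited_capacity_all_but_one_extinct
    {Ω : Type*} [mΩ : MeasurableSpace Ω] {μ : Measure Ω} {k : ℕ} {lam : ℝ}
    (M : InfiniteExemplarModel Ω μ k lam) :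
    ∀ᵐ ω ∂μ, ∃! j : Fin k,
      Tendsto (fun n => M.W n j ω / (∑ i : Fin k, M.W n i ω)) atTop (𝓝 1) ∧
      ∀ i : Fin k, i ≠ j → Tendsto (fun n => M.W n i ω) atTop (𝓝 0) := by
  filter_upwards [ae_all_iff.2 M.ae_exists_tendsto_share] with ω hω
  obtain ⟨j, hj⟩ : ∃ j, ∃ᶠ n in atTop, M.x n ω = j := by
    by_contra! h
    obtain ⟨n, hn⟩ := (eventually_all.2 h).exists
    exact hn _ rfl
  obtain ⟨c, hc⟩ := hω j
  have h1 := M.tendsto_share_one hc hj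
  refine ⟨j, ⟨h1, fun i hi => M.tendsto_W_zero hi h1⟩, fun j' hj' => ?_⟩
  by_contra hne
  have h0 := M.tendsto_W_zero hne h1
  have hle := le_of_tendsto_of_tendsto' ((tendsto_add_atTop_iff_nat 1).2 hj'.1)
    ((tendsto_add_atTop_iff_nat 1).2 h0) fun n => M.share_succ_le_W j' n ω
  linarith
end
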